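/- Lemma 1 (SIT duality, attained form). Let X be a metric space, D ⊆ X compact, and f g : X → ℝ continuous. Let ε > 0 and δ ∈ ℝ. Then the following are equivalent: (a) every x ∈ D with g x ≤ −ε satisfies f x < δ (i.e., the ε-essential optimal value of the primal problem max f subject to g ≤ −ε over D is less than δ); (b) sInf (g '' {x ∈ D | f x ≥ δ}) > −ε (the optimal value of the SIT dual problem min g subject to f ≥ δ over D exceeds −ε), where in case {x ∈ D | f x ≥ δ} = ∅ the set g '' {x ∈ D | f x ≥ δ} is empty and (b) holds by Lean's convention sInf ∅ = 0 together with ε > 0. -/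

import Mathlib

/-- Lemma 1 (SIT duality, attained form): the ε-essential optimal value of the primal
problem `max f s.t. g ≤ -ε` over a compact set `D` is less than `δ` iff the optimal value
of the SIT dual `min g s.t. f ≥ δ` over `D` exceeds `-ε`. -/
theorem sit_duality {X : Type*} [MetricSpace X] (D : Set X) (hD : IsCompact D)
    (f g : X → ℝ) (hf : Continuous f) (hg : Continuous g)
    (ε : ℝ) (hε : 0 < ε) (δ : ℝ) :
    (∀ x ∈ D, g x ≤ -ε → f x < δ) ↔ sInf (g '' {x ∈ D | f x ≥ δ}) > -ε := by
  have hK : IsCompact (g '' {x ∈ D | f x ≥ δ}) :=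
    (hD.inter_right (isClosed_le continuous_const hf)).image hg
  constructor
  · intro h
    rcases (g '' {x ∈ D | f x ≥ δ}).eq_empty_or_nonempty with he | hne
    · rw [he, Real.sInf_empty]
      linarith
    · obtain ⟨x, ⟨hxD, hfx⟩, hx⟩ := hK.sInf_mem hne
      rw [← hx]
      by_contra! hgx
      exact (h x hxD hgx).not_ge hfx
  · intro h x hxD hgx
    by_contra! hfx
    have hle : sInf (g '' {x ∈ D | f x ≥ δ}) ≤ g x :=
      csInf_le hK.bddBelow ⟨x, ⟨hxD, hfx⟩, rfl⟩
    linarith
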